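/- Let Vx, Vy, Vz, Px, Py, Pz, Ix, Iy, Iz be real numbers (the coordinates of a verifier V, a prover P and an intruder I in three-dimensional space), and let dVI, dPI, dVP, d be real numbers such that the location constraints ⌊d(V,I)⌋, ⌊d(P,I)⌋, ⌊d(V,P)⌋ hold, i.e., dVI ≥ 0, dPI ≥ 0, dVP ≥ 0 and dVI^2 = (Vx−Ix)^2 + (Vy−Iy)^2 + (Vz−Iz)^2, dPI^2 = (Px−Ix)^2 + (Py−Iy)^2 + (Pz−Iz)^2, dVP^2 = (Vx−Px)^2 + (Vy−Py)^2 + (Vz−Pz)^2. If dVP > d and d > 0, then it is not the case that 2·dVI + 2·dPI ≤ 2·d. -/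

import Mathlib

/-- Cauchy–Schwarz in three real coordinates, for given nonnegative norms `r` and `s`. -/
theorem neg_dot_le_mul_of_sq_eq {a b c x y z r s : ℝ} (hr : 0 ≤ r) (hs : 0 ≤ s)
    (hr2 : r ^ 2 = a ^ 2 + b ^ 2 + c ^ 2) (hs2 : s ^ 2 = x ^ 2 + y ^ 2 + z ^ 2) :
    -(a * x + b * y + c * z) ≤ r * s := by
  refine (abs_le_of_sq_le_sq' ?_ (mul_nonneg hr hs)).2
  rw [mul_pow, hr2, hs2]
  nlinarith [sq_nonneg (a * y - b * x), sq_nonneg (a * z - c * x), sq_nonneg (b * z - c * y)]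

theorem mafia_fraud_unfeasible_3d
    (Vx Vy Vz Px Py Pz Ix Iy Iz : ℝ)
    (dVI dPI dVP d : ℝ)
    (hVI0 : dVI ≥ 0) (hPI0 : dPI ≥ 0) (hVP0 : dVP ≥ 0)
    (hVI : dVI ^ 2 = (Vx - Ix) ^ 2 + (Vy - Iy) ^ 2 + (Vz - Iz) ^ 2)
    (hPI : dPI ^ 2 = (Px - Ix) ^ 2 + (Py - Iy) ^ 2 + (Pz - Iz) ^ 2)
    (hVP : dVP ^ 2 = (Vx - Px) ^ 2 + (Vy - Py) ^ 2 + (Vz - Pz) ^ 2)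
    (hVPd : dVP > d) (hd : d > 0) :
    ¬ (2 * dVI + 2 * dPI ≤ 2 * d) := by
  intro h
  have hdot := neg_dot_le_mul_of_sq_eq hVI0 hPI0 hVI hPI
  have htri : dVP ≤ dVI + dPI := by
    refine (abs_le_of_sq_le_sq' ?_ (add_nonneg hVI0 hPI0)).2
    rw [add_sq, hVI, hPI, hVP]
    linarith
  linarith
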